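/- Assume that the family B and the family (G,B) both satisfy positivity, and that A_k ⊥⊥ G_k | B_k for every k = 0,…,p. Then the influence-function variances satisfy Var(ψ_a(B)) − Var(ψ_a((G,B))) ≥ 0. (Lemma 4.1 of the paper, counterfactual-mean version, stated purely probabilistically.) -/

import Mathlib

open MeasureTheory ProbabilityTheory

noncomputable section

/-- The σ-algebra generated by a set of real-valued random variables. -/
def genSig {Ω : Type*} (S : Set (Ω → ℝ)) : MeasurableSpace Ω :=
  ⨆ f ∈ S, MeasurableSpace.comap f (inferInstance : MeasurableSpace ℝ)

/-- Indicator `1_{A = a}` of the event that the random variable `A` takes the value `a`. -/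
def ind {Ω : Type*} (A : Ω → ℝ) (a : ℝ) : Ω → ℝ := fun ω => if A ω = a then 1 else 0

/-- `I_{ā_{k-1}}(Ā_{k-1}) = ∏_{j<k} 1_{A_j = a_j}` (equal to `1` when `k = 0`). -/
def indUpto {Ω : Type*} (A : ℕ → Ω → ℝ) (a : ℕ → ℝ) (k : ℕ) : Ω → ℝ :=
  fun ω => ∏ j ∈ Finset.range k, ind (A j) (a j) ω

variable {Ω : Type*} [MeasurableSpace Ω]

/-- Propensity `π_{a_k}(Z_k) = E[1_{A_k = a_k} ∣ σ(Z_k)]`. -/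
def propen (μ : Measure Ω) (A : ℕ → Ω → ℝ) (a : ℕ → ℝ) (Z : ℕ → Set (Ω → ℝ)) (k : ℕ) : Ω → ℝ :=
  μ[ind (A k) (a k) | genSig (Z k)]

/-- Cumulative weight `λ_{ā_{k-1}}(Z̄_{k-1}) = ∏_{j<k} π_{a_j}(Z_j)` (equal to `1` when `k = 0`). -/
def cumWeight (μ : Measure Ω) (A : ℕ → Ω → ℝ) (a : ℕ → ℝ) (Z : ℕ → Set (Ω → ℝ)) (k : ℕ) :
    Ω → ℝ :=
  fun ω => ∏ j ∈ Finset.range k, propen μ A a Z j ω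

/-- The adjustment family `Z` satisfies positivity: the propensities are uniformly bounded away
from `0` almost surely, for every time `k = 0, …, p`. -/
def Positivity (μ : Measure Ω) (A : ℕ → Ω → ℝ) (a : ℕ → ℝ) (Z : ℕ → Set (Ω → ℝ)) (p : ℕ) :
    Prop :=
  ∃ c : ℝ, 0 < c ∧ ∀ k ≤ p, ∀ᵐ ω ∂μ, c ≤ propen μ A a Z k ω

/-- Auxiliary downward recursion: `bAux μ A a Y Z p n` is the iterated regression
`b_{a_{p-n}}(Z)`. -/
def bAux (μ : Measure Ω) (A : ℕ → Ω → ℝ) (a : ℕ → ℝ) (Y : Ω → ℝ) (Z : ℕ → Set (Ω → ℝ))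
    (p : ℕ) : ℕ → Ω → ℝ
  | 0 => fun ω =>
      (μ[fun ω' => Y ω' * ind (A p) (a p) ω' | genSig (Z p)]) ω / propen μ A a Z p ω
  | n + 1 => fun ω =>
      (μ[fun ω' => bAux μ A a Y Z p n ω' * ind (A (p - (n + 1))) (a (p - (n + 1))) ω' |
          genSig (Z (p - (n + 1)))]) ω / propen μ A a Z (p - (n + 1)) ω

/-- Iterated regression `b_{a_k}(Z)`, for `k = 0, …, p`. -/
def breg (μ : Measure Ω) (A : ℕ → Ω → ℝ) (a : ℕ → ℝ) (Y : Ω → ℝ) (Z : ℕ → Set (Ω → ℝ))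
    (p k : ℕ) : Ω → ℝ :=
  bAux μ A a Y Z p (p - k)

/-- `b_{a_{k-1}}(Z)` with the convention `b_{a_{-1}}(Z) = E[b_{a_0}(Z)]` (a constant). -/
def bregPrev (μ : Measure Ω) (A : ℕ → Ω → ℝ) (a : ℕ → ℝ) (Y : Ω → ℝ) (Z : ℕ → Set (Ω → ℝ))
    (p k : ℕ) : Ω → ℝ :=
  if k = 0 then fun _ => ∫ ω, breg μ A a Y Z p 0 ω ∂μ else breg μ A a Y Z p (k - 1)

/-- The influence function `ψ_a(Z)`. -/
def psi (μ : Measure Ω) (A : ℕ → Ω → ℝ) (a : ℕ → ℝ) (Y : Ω → ℝ) (Z : ℕ → Set (Ω → ℝ))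
    (p : ℕ) : Ω → ℝ := fun ω =>
  indUpto A a (p + 1) ω * (Y ω - breg μ A a Y Z p p ω) / cumWeight μ A a Z (p + 1) ω +
    ∑ k ∈ Finset.range (p + 1),
      indUpto A a k ω * (breg μ A a Y Z p k ω - bregPrev μ A a Y Z p k ω) /
        cumWeight μ A a Z k ω

end

section Conditioning

variable {Ω : Type*} {m m₁ m₂ mΩ : MeasurableSpace Ω} {μ : Measure Ω}

lemma memLp_top_mul {f g : Ω → ℝ} (hf : MemLp f ⊤ μ) (hg : MemLp g ⊤ μ) :
    MemLp (fun ω => f ω * g ω) ⊤ μ :=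
  MemLp.mul' hg hf

lemma integrable_of_memLp_top [IsFiniteMeasure μ] {f : Ω → ℝ} (hf : MemLp f ⊤ μ) :
    Integrable f μ :=
  hf.integrable le_top

/-- Conditional expectation is self-adjoint against bounded `m`-measurable functions. -/
lemma integral_mul_condExp_of_memLp_top [IsFiniteMeasure μ] (hm : m ≤ mΩ) {f g : Ω → ℝ}
    (hg : Measurable[m] g) (hgb : MemLp g ⊤ μ) (hf : MemLp f ⊤ μ) :
    ∫ ω, g ω * (μ[f|m]) ω ∂μ = ∫ ω, g ω * f ω ∂μ := by
  have h := condExp_mul_of_stronglyMeasurable_left (μ := μ) (m := m) (f := g) (g := f)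
    hg.stronglyMeasurable (integrable_of_memLp_top (memLp_top_mul hgb hf))
    (integrable_of_memLp_top hf)
  rw [← integral_condExp hm (f := fun ω => g ω * f ω)]
  exact (integral_congr_ae h).symm

lemma measurableSpace_sup_eq_generateFrom_inter (m₁ m₂ : MeasurableSpace Ω) :
    m₁ ⊔ m₂ = MeasurableSpace.generateFrom
      {u | ∃ s t, MeasurableSet[m₁] s ∧ MeasurableSet[m₂] t ∧ u = s ∩ t} := by
  apply le_antisymm
  · refine sup_le (fun s hs => ?_) (fun t ht => ?_)
    · exact MeasurableSpace.measurableSet_generateFrom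
        ⟨s, Set.univ, hs, MeasurableSet.univ, (Set.inter_univ s).symm⟩
    · exact MeasurableSpace.measurableSet_generateFrom
        ⟨Set.univ, t, MeasurableSet.univ, ht, (Set.univ_inter t).symm⟩
  · refine MeasurableSpace.generateFrom_le ?_
    rintro _ ⟨s, t, hs, ht, rfl⟩
    exact MeasurableSet.inter ((le_sup_left : m₁ ≤ m₁ ⊔ m₂) s hs)
      ((le_sup_right : m₂ ≤ m₁ ⊔ m₂) t ht)

lemma isPiSystem_measurableSet_inter (m₁ m₂ : MeasurableSpace Ω) :
    IsPiSystem {u | ∃ s t, MeasurableSet[m₁] s ∧ MeasurableSet[m₂] t ∧ u = s ∩ t} := by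
  rintro _ ⟨s, t, hs, ht, rfl⟩ _ ⟨s', t', hs', ht', rfl⟩ _
  exact ⟨s ∩ s', t ∩ t', hs.inter hs', ht.inter ht', Set.inter_inter_inter_comm s t s' t'⟩

/-- If `m₁` and `m₂` are conditionally independent given `m`, enlarging the conditioning
σ-algebra `m` by `m₂` does not change the conditional probability of an event of `m₁`. -/
lemma condExp_indicator_sup_of_condIndep [StandardBorelSpace Ω] [IsFiniteMeasure μ]
    (hm : m ≤ mΩ) (hm₁ : m₁ ≤ mΩ) (hm₂ : m₂ ≤ mΩ)
    (hCI : CondIndep m m₁ m₂ hm μ) {s : Set Ω} (hs : MeasurableSet[m₁] s) :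
    μ[s.indicator (fun _ => (1 : ℝ))|m₂ ⊔ m] =ᵐ[μ] μ[s.indicator (fun _ => (1 : ℝ))|m] := by
  have hsup : m₂ ⊔ m ≤ mΩ := sup_le hm₂ hm
  have hind : ∀ u : Set Ω, MeasurableSet u →
      MemLp (u.indicator (fun _ => (1 : ℝ))) ⊤ μ := fun u hu =>
    (memLp_const (1 : ℝ)).indicator hu
  have hfi := integrable_of_memLp_top (hind s (hm₁ s hs))
  have hgi : Integrable (μ[s.indicator (fun _ => (1 : ℝ))|m]) μ := integrable_condExp
  have hgm : StronglyMeasurable[m₂ ⊔ m] (μ[s.indicator (fun _ => (1 : ℝ))|m]) :=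
    stronglyMeasurable_condExp.mono le_sup_right
  symm
  refine ae_eq_condExp_of_forall_setIntegral_eq hsup hfi (fun _ _ _ => hgi.integrableOn) ?_
    hgm.aestronglyMeasurable
  intro u hu _
  induction u, hu using MeasurableSpace.induction_on_inter
    (measurableSpace_sup_eq_generateFrom_inter m₂ m) (isPiSystem_measurableSet_inter m₂ m) with
  | empty => simp
  | basic u hu =>
    obtain ⟨t, r, ht, hr, rfl⟩ := hu
    have ht' := hm₂ t ht
    have hr' := hm r hr
    have hprod := (condIndep_iff m m₁ m₂ hm hm₁ hm₂ μ).1 hCI s t hs ht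
    have key : ∀ f : Ω → ℝ, ∫ ω in t ∩ r, f ω ∂μ
        = ∫ ω, (r.indicator (fun _ => (1 : ℝ)) ω) * (t.indicator (fun _ => (1 : ℝ)) ω * f ω) ∂μ := by
      intro f
      rw [← integral_indicator (ht'.inter hr')]
      refine integral_congr_ae (Filter.Eventually.of_forall fun ω => ?_)
      by_cases h1 : ω ∈ t <;> by_cases h2 : ω ∈ r <;> simp [h1, h2]
    have hrm : Measurable[m] (r.indicator (fun _ => (1 : ℝ))) :=
      Measurable.indicator measurable_const hr
    have hcb : MemLp (μ[s.indicator (fun _ => (1 : ℝ))|m]) ⊤ μ :=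
      (hind s (hm₁ s hs)).condExp le_top
    rw [key, key]
    calc _ = ∫ ω, ((r.indicator (fun _ => (1 : ℝ)) ω) * (μ[s.indicator (fun _ => (1 : ℝ))|m]) ω)
            * t.indicator (fun _ => (1 : ℝ)) ω ∂μ := by
          congr 1; ext ω; ring
      _ = ∫ ω, ((r.indicator (fun _ => (1 : ℝ)) ω) * (μ[s.indicator (fun _ => (1 : ℝ))|m]) ω)
            * (μ[t.indicator (fun _ => (1 : ℝ))|m]) ω ∂μ :=
          (integral_mul_condExp_of_memLp_top hm
            (hrm.mul stronglyMeasurable_condExp.measurable)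
            (memLp_top_mul (hind r hr') hcb) (hind t ht')).symm
      _ = ∫ ω, (r.indicator (fun _ => (1 : ℝ)) ω)
            * (μ[(s ∩ t).indicator (fun _ => (1 : ℝ))|m]) ω ∂μ := by
          refine integral_congr_ae ?_
          filter_upwards [hprod] with ω hω
          rw [hω, Pi.mul_apply, mul_assoc]
      _ = ∫ ω, (r.indicator (fun _ => (1 : ℝ)) ω)
            * (s ∩ t).indicator (fun _ => (1 : ℝ)) ω ∂μ :=
          integral_mul_condExp_of_memLp_top hm hrm (hind r hr')
            (hind _ ((hm₁ s hs).inter ht'))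
      _ = _ := by
          congr 1; ext ω
          by_cases h1 : ω ∈ t <;> by_cases h2 : ω ∈ s <;> simp [h1, h2]
  | compl u hu ih =>
    have h1 := integral_add_compl (hsup u hu) hgi
    have h2 := integral_add_compl (hsup u hu) hfi
    have h3 : ∫ ω, (μ[s.indicator (fun _ => (1 : ℝ))|m]) ω ∂μ = _ := integral_condExp hm
    have h4 := ih (measure_lt_top _ _)
    linarith
  | iUnion f hd hf ih =>
    rw [integral_iUnion (fun i => hsup _ (hf i)) hd hgi.integrableOn,
      integral_iUnion (fun i => hsup _ (hf i)) hd hfi.integrableOn]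
    exact tsum_congr fun i => ih i (measure_lt_top _ _)

end Conditioning

section InfluenceFunction

lemma genSig_mono {Ω : Type*} {S T : Set (Ω → ℝ)} (h : S ⊆ T) : genSig S ≤ genSig T :=
  biSup_mono h

lemma genSig_union {Ω : Type*} (S T : Set (Ω → ℝ)) : genSig (S ∪ T) = genSig S ⊔ genSig T :=
  iSup_union

lemma measurable_genSig_of_mem {Ω : Type*} {S : Set (Ω → ℝ)} {f : Ω → ℝ} (hf : f ∈ S) :
    Measurable[genSig S] f :=
  measurable_iff_comap_le.2
    (le_biSup (fun f : Ω → ℝ => MeasurableSpace.comap f inferInstance) hf)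

lemma measurable_ind {Ω : Type*} {m : MeasurableSpace Ω} {X : Ω → ℝ} (hX : Measurable X) (x : ℝ) :
    Measurable (ind X x) :=
  Measurable.ite (hX (measurableSet_singleton x)) measurable_const measurable_const

lemma indUpto_mul_indUpto {Ω : Type*} {A : ℕ → Ω → ℝ} {a : ℕ → ℝ}
    {j k : ℕ} (hkj : k ≤ j) (ω : Ω) :
    indUpto A a j ω * indUpto A a k ω = indUpto A a j ω := by
  by_cases h : ∃ i ∈ Finset.range j, ind (A i) (a i) ω = 0
  · obtain ⟨i, hi, h0⟩ := h
    have : indUpto A a j ω = 0 := Finset.prod_eq_zero hi h0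
    rw [this, zero_mul]
  · push Not at h
    have : indUpto A a k ω = 1 := Finset.prod_eq_one fun i hi => by
      have := h i (Finset.mem_range.2 ((Finset.mem_range.1 hi).trans_le hkj))
      unfold ind at this ⊢
      split_ifs at this ⊢ <;> simp_all
    rw [this, mul_one]

variable {Ω : Type*} [mΩ : MeasurableSpace Ω] {μ : Measure Ω} {A : ℕ → Ω → ℝ}
  {a : ℕ → ℝ} {Y : Ω → ℝ} {Z : ℕ → Set (Ω → ℝ)} {p : ℕ}

lemma memLp_top_ind [IsFiniteMeasure μ] {X : Ω → ℝ} (hX : Measurable X) (x : ℝ) :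
    MemLp (ind X x) ⊤ μ := by
  refine memLp_top_of_bound (measurable_ind hX x).aestronglyMeasurable 1
    (Filter.Eventually.of_forall fun ω => ?_)
  unfold ind
  split_ifs <;> simp

lemma measurable_propen (k : ℕ) : Measurable[genSig (Z k)] (propen μ A a Z k) :=
  stronglyMeasurable_condExp.measurable

lemma memLp_top_propen_inv (hle : ∀ k ≤ p, genSig (Z k) ≤ mΩ) (hpos : Positivity μ A a Z p)
    {k : ℕ} (hk : k ≤ p) : MemLp (fun ω => (propen μ A a Z k ω)⁻¹) ⊤ μ := by
  obtain ⟨c, hc, h⟩ := hpos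
  refine memLp_top_of_bound
    ((measurable_propen k).mono (hle k hk) le_rfl).inv.aestronglyMeasurable c⁻¹ ?_
  filter_upwards [h k hk] with ω hω
  rw [norm_inv, Real.norm_eq_abs, abs_of_pos (hc.trans_le hω)]
  exact inv_anti₀ hc hω

lemma propen_ne_zero (hpos : Positivity μ A a Z p) {k : ℕ} (hk : k ≤ p) :
    ∀ᵐ ω ∂μ, propen μ A a Z k ω ≠ 0 := by
  obtain ⟨c, hc, h⟩ := hpos
  filter_upwards [h k hk] with ω hω using (hc.trans_le hω).ne'

/-- The inverse probability weight `I_{ā_{k-1}}(Ā_{k-1}) / λ_{ā_{k-1}}(Z̄_{k-1})`. -/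
noncomputable def ipWeight (μ : Measure Ω) (A : ℕ → Ω → ℝ) (a : ℕ → ℝ) (Z : ℕ → Set (Ω → ℝ)) (k : ℕ) :
    Ω → ℝ :=
  fun ω => indUpto A a k ω * (cumWeight μ A a Z k ω)⁻¹

/-- The sequence `b_{a_{-1}}, b_{a_0}, …, b_{a_p}, Y`. -/
noncomputable def regSeq (μ : Measure Ω) (A : ℕ → Ω → ℝ) (a : ℕ → ℝ) (Y : Ω → ℝ) (Z : ℕ → Set (Ω → ℝ))
    (p k : ℕ) : Ω → ℝ :=
  if k = p + 2 then Y else bregPrev μ A a Y Z p k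

lemma regSeq_last : regSeq μ A a Y Z p (p + 2) = Y := if_pos rfl

lemma regSeq_zero :
    regSeq μ A a Y Z p 0 = fun _ => ∫ ω, breg μ A a Y Z p 0 ω ∂μ := by
  simp [regSeq, bregPrev]

lemma regSeq_succ {k : ℕ} (hk : k ≤ p) :
    regSeq μ A a Y Z p (k + 1) = breg μ A a Y Z p k := by
  simp [regSeq, bregPrev, show k ≠ p + 1 by omega]

lemma regSeq_succ_eq_condExp_div {k : ℕ} (hk : k ≤ p) :
    regSeq μ A a Y Z p (k + 1) = fun ω =>
      (μ[fun ω' => regSeq μ A a Y Z p (k + 2) ω' * ind (A k) (a k) ω' | genSig (Z k)]) ω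
        / propen μ A a Z k ω := by
  rw [regSeq_succ hk]
  rcases hk.eq_or_lt with rfl | hlt
  · simp only [breg, Nat.sub_self, bAux, regSeq_last]
  · rw [regSeq_succ (k := k + 1) hlt]
    obtain ⟨n, rfl⟩ := Nat.exists_eq_add_of_le (Nat.succ_le_of_lt hlt)
    have h1 : k.succ + n - k = n + 1 := by omega
    have h2 : k.succ + n - (k + 1) = n := by omega
    have h3 : k.succ + n - (n + 1) = k := by omega
    simp only [breg, h1, h2, bAux, h3]

lemma psi_eq_sum_ipWeight_mul : psi μ A a Y Z p = fun ω =>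
    ∑ k ∈ Finset.range (p + 2), ipWeight μ A a Z k ω *
      (regSeq μ A a Y Z p (k + 1) ω - regSeq μ A a Y Z p k ω) := by
  ext ω
  rw [Finset.sum_range_succ, regSeq_last, regSeq_succ le_rfl, psi, add_comm]
  congr 1
  · refine Finset.sum_congr rfl fun k hk => ?_
    have hk' := Finset.mem_range.1 hk
    rw [regSeq_succ (Nat.lt_succ_iff.1 hk'), regSeq, if_neg (by omega), ipWeight]
    ring
  · rw [ipWeight]
    ring

lemma ipWeight_zero (ω : Ω) : ipWeight μ A a Z 0 ω = 1 := by
  simp [ipWeight, indUpto, cumWeight]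

lemma ipWeight_succ (k : ℕ) (ω : Ω) : ipWeight μ A a Z (k + 1) ω =
    ipWeight μ A a Z k ω * (propen μ A a Z k ω)⁻¹ * ind (A k) (a k) ω := by
  simp only [ipWeight, indUpto, cumWeight, Finset.prod_range_succ, mul_inv]
  ring

lemma ipWeight_mul_ipWeight {j k : ℕ} (hkj : k ≤ j) (ω : Ω) :
    ipWeight μ A a Z j ω * ipWeight μ A a Z k ω =
      ipWeight μ A a Z j ω * (cumWeight μ A a Z k ω)⁻¹ := by
  have h := indUpto_mul_indUpto (A := A) (a := a) hkj ω
  simp only [ipWeight]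
  linear_combination (cumWeight μ A a Z j ω)⁻¹ * (cumWeight μ A a Z k ω)⁻¹ * h

lemma measurable_cumWeight_inv {S : Set (Ω → ℝ)} {k : ℕ}
    (h : ∀ i < k, genSig (Z i) ≤ genSig S) : Measurable[genSig S] fun ω => (cumWeight μ A a Z k ω)⁻¹ := by
  refine Measurable.inv ?_
  exact Finset.measurable_fun_prod _ fun i hi =>
    (measurable_propen i).mono (h i (Finset.mem_range.1 hi)) le_rfl

lemma measurable_ipWeight {S : Set (Ω → ℝ)} {k : ℕ}
    (h : ∀ i < k, genSig (Z i) ≤ genSig S) (hA : ∀ i < k, Measurable[genSig S] (A i)) :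
    Measurable[genSig S] (ipWeight μ A a Z k) := by
  refine Measurable.mul ?_ (measurable_cumWeight_inv h)
  exact Finset.measurable_fun_prod _ fun i hi =>
    measurable_ind (hA i (Finset.mem_range.1 hi)) _

lemma measurable_regSeq_succ {k : ℕ} (hk : k ≤ p) :
    Measurable[genSig (Z k)] (regSeq μ A a Y Z p (k + 1)) := by
  rw [regSeq_succ_eq_condExp_div hk]
  exact stronglyMeasurable_condExp.measurable.div (measurable_propen k)

variable [IsProbabilityMeasure μ]

lemma memLp_top_cumWeight_inv (hle : ∀ k ≤ p, genSig (Z k) ≤ mΩ) (hpos : Positivity μ A a Z p)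
    {k : ℕ} (hk : k ≤ p + 1) : MemLp (fun ω => (cumWeight μ A a Z k ω)⁻¹) ⊤ μ := by
  induction k with
  | zero => simpa [cumWeight] using memLp_const (1 : ℝ)
  | succ k ih =>
    simp only [cumWeight, Finset.prod_range_succ, mul_inv]
    exact memLp_top_mul (ih (by omega)) (memLp_top_propen_inv hle hpos (by omega))

lemma memLp_top_ipWeight (hA : ∀ k, Measurable (A k)) (hle : ∀ k ≤ p, genSig (Z k) ≤ mΩ)
    (hpos : Positivity μ A a Z p) {k : ℕ} (hk : k ≤ p + 1) :
    MemLp (ipWeight μ A a Z k) ⊤ μ := by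
  induction k with
  | zero =>
    have : ipWeight μ A a Z 0 = fun _ => 1 := funext ipWeight_zero
    rw [this]
    exact memLp_const 1
  | succ k ih =>
    have : ipWeight μ A a Z (k + 1) = fun ω => _ := funext (ipWeight_succ k)
    rw [this]
    exact memLp_top_mul (memLp_top_mul (ih (by omega))
      (memLp_top_propen_inv hle hpos (by omega))) (memLp_top_ind (hA k) _)

lemma memLp_top_regSeq (hA : ∀ k, Measurable (A k)) (hY : MemLp Y ⊤ μ)
    (hle : ∀ k ≤ p, genSig (Z k) ≤ mΩ) (hpos : Positivity μ A a Z p) {k : ℕ} (hk : k ≤ p + 2) :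
    MemLp (regSeq μ A a Y Z p k) ⊤ μ := by
  rcases k with _ | k
  · rw [regSeq_zero]
    exact memLp_const _
  · have hstep : ∀ n ≤ p + 1, MemLp (regSeq μ A a Y Z p (p + 2 - n)) ⊤ μ := by
      intro n hn
      induction n with
      | zero => simpa [regSeq_last] using hY
      | succ n ih =>
        have h1 : p + 2 - (n + 1) = (p - n) + 1 := by omega
        have h2 : p + 2 - n = (p - n) + 2 := by omega
        rw [h1, regSeq_succ_eq_condExp_div (Nat.sub_le p n)]
        simp only [div_eq_mul_inv]
        have ih' := ih (by omega)
        rw [h2] at ih'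
        exact memLp_top_mul ((memLp_top_mul ih' (memLp_top_ind (hA _) _)).condExp le_top)
          (memLp_top_propen_inv hle hpos (Nat.sub_le p n))
    have := hstep (p + 2 - (k + 1)) (by omega)
    rwa [show p + 2 - (p + 2 - (k + 1)) = k + 1 by omega] at this

/-- Weight increments are orthogonal to the past. -/
lemma integral_mul_ipWeight_sub_succ (hA : ∀ k, Measurable (A k))
    (hle : ∀ k ≤ p, genSig (Z k) ≤ mΩ)
    (hmono : ∀ i j, i ≤ j → j ≤ p → genSig (Z i) ≤ genSig (Z j))
    (hadapt : ∀ i j, i < j → j ≤ p → Measurable[genSig (Z j)] (A i))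
    (hpos : Positivity μ A a Z p) {k : ℕ} (hk : k ≤ p) {h : Ω → ℝ}
    (hh : Measurable[genSig (Z k)] h) (hhb : MemLp h ⊤ μ) :
    ∫ ω, h ω * (ipWeight μ A a Z k ω - ipWeight μ A a Z (k + 1) ω) ∂μ = 0 := by
  set π := propen μ A a Z k
  set w := ipWeight μ A a Z k
  have hw : Measurable[genSig (Z k)] w := measurable_ipWeight
    (fun i hi => hmono i k hi.le hk) (fun i hi => hadapt i k hi hk)
  have hwb : MemLp w ⊤ μ := memLp_top_ipWeight hA hle hpos (by omega)
  have hπ : Measurable[genSig (Z k)] π := measurable_propen k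
  have hπb := memLp_top_propen_inv hle hpos hk
  have heb : MemLp (ind (A k) (a k)) ⊤ μ := memLp_top_ind (hA k) _
  have hgm : Measurable[genSig (Z k)] fun ω => h ω * w ω * (π ω)⁻¹ :=
    (hh.mul hw).mul hπ.inv
  have hgb : MemLp (fun ω => h ω * w ω * (π ω)⁻¹) ⊤ μ :=
    memLp_top_mul (memLp_top_mul hhb hwb) hπb
  have key := integral_mul_condExp_of_memLp_top (hle k hk) hgm hgb heb
  have hcancel : ∫ ω, h ω * w ω * (π ω)⁻¹ * (μ[ind (A k) (a k)|genSig (Z k)]) ω ∂μ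
      = ∫ ω, h ω * w ω ∂μ := by
    refine integral_congr_ae ?_
    filter_upwards [propen_ne_zero hpos hk] with ω hω
    exact inv_mul_cancel_right₀ hω _
  calc _ = ∫ ω, (h ω * w ω - h ω * w ω * (π ω)⁻¹ * ind (A k) (a k) ω) ∂μ := by
        congr 1; ext ω; rw [ipWeight_succ]; ring
    _ = 0 := by
        rw [integral_sub (integrable_of_memLp_top (memLp_top_mul hhb hwb))
          (integrable_of_memLp_top (memLp_top_mul hgb heb)), ← key, hcancel, sub_self]

/-- Weighted regression residuals are orthogonal to the past. -/
lemma integral_mul_ind_mul_regSeq_sub (hA : ∀ k, Measurable (A k)) (hY : MemLp Y ⊤ μ)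
    (hle : ∀ k ≤ p, genSig (Z k) ≤ mΩ) (hpos : Positivity μ A a Z p) {k : ℕ} (hk : k ≤ p)
    {h : Ω → ℝ} (hh : Measurable[genSig (Z k)] h) (hhb : MemLp h ⊤ μ) :
    ∫ ω, h ω * ind (A k) (a k) ω *
      (regSeq μ A a Y Z p (k + 2) ω - regSeq μ A a Y Z p (k + 1) ω) ∂μ = 0 := by
  set e := ind (A k) (a k) with he
  set f := regSeq μ A a Y Z p (k + 2) with hf
  set g := regSeq μ A a Y Z p (k + 1) with hg
  have hfb : MemLp f ⊤ μ := memLp_top_regSeq hA hY hle hpos (by omega)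
  have hgb : MemLp g ⊤ μ := memLp_top_regSeq hA hY hle hpos (by omega)
  have hgm : Measurable[genSig (Z k)] g := measurable_regSeq_succ hk
  have heb : MemLp e ⊤ μ := memLp_top_ind (hA k) _
  have h1 := integral_mul_condExp_of_memLp_top (hle k hk) hh hhb (memLp_top_mul hfb heb)
  have h2 := integral_mul_condExp_of_memLp_top (hle k hk) (hh.mul hgm)
    (memLp_top_mul hhb hgb) heb
  have h3 : ∫ ω, h ω * (μ[fun ω' => f ω' * e ω'|genSig (Z k)]) ω ∂μ
      = ∫ ω, h ω * g ω * (μ[e|genSig (Z k)]) ω ∂μ := by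
    refine integral_congr_ae ?_
    filter_upwards [propen_ne_zero hpos hk] with ω hω
    have : g ω = _ := congrFun (regSeq_succ_eq_condExp_div hk) ω
    rw [this, mul_assoc]
    congr 1
    exact (div_mul_cancel₀ _ hω).symm
  calc _ = ∫ ω, (h ω * (f ω * e ω) - h ω * g ω * e ω) ∂μ := by
        congr 1; ext ω; ring
    _ = 0 := by
        rw [integral_sub (integrable_of_memLp_top (memLp_top_mul hhb (memLp_top_mul hfb heb)))
          (integrable_of_memLp_top (memLp_top_mul (memLp_top_mul hhb hgb) heb)), ← h1, h3]
        exact sub_eq_zero.2 h2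

lemma integral_ipWeight_mul_regSeq_sub_mul (hA : ∀ k, Measurable (A k)) (hY : MemLp Y ⊤ μ)
    (hle : ∀ k ≤ p, genSig (Z k) ≤ mΩ)
    (hmono : ∀ i j, i ≤ j → j ≤ p → genSig (Z i) ≤ genSig (Z j))
    (hadapt : ∀ i j, i < j → j ≤ p → Measurable[genSig (Z j)] (A i))
    (hpos : Positivity μ A a Z p) {j k : ℕ} (hj : j ≤ p + 1) (hk : k ≤ p) {h : Ω → ℝ}
    (hh : Measurable[genSig (Z k)] h) (hhb : MemLp h ⊤ μ) :
    ∫ ω, ipWeight μ A a Z j ω * (regSeq μ A a Y Z p (j + 1) ω - regSeq μ A a Y Z p j ω) *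
      (h ω * (ipWeight μ A a Z k ω - ipWeight μ A a Z (k + 1) ω)) ∂μ = 0 := by
  have hβ : ∀ {i}, i ≤ p + 2 → MemLp (regSeq μ A a Y Z p i) ⊤ μ :=
    fun hi => memLp_top_regSeq hA hY hle hpos hi
  have hw : ∀ {i}, i ≤ p + 1 → MemLp (ipWeight μ A a Z i) ⊤ μ :=
    fun hi => memLp_top_ipWeight hA hle hpos hi
  rcases le_or_gt j k with hjk | hkj
  · have hβm : ∀ i ≤ k + 1, Measurable[genSig (Z k)] (regSeq μ A a Y Z p i) := by
      rintro (_ | i) hi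
      · rw [regSeq_zero]
        exact measurable_const
      · exact (measurable_regSeq_succ (by omega)).mono (hmono i k (by omega) hk) le_rfl
    have hwm : Measurable[genSig (Z k)] (ipWeight μ A a Z j) := measurable_ipWeight (k := j)
      (fun i hi => hmono i k (by omega) hk) (fun i hi => hadapt i k (by omega) hk)
    rw [← integral_mul_ipWeight_sub_succ hA hle hmono hadapt hpos hk
      ((hwm.mul ((hβm (j + 1) (by omega)).sub (hβm j (by omega)))).mul hh)
      (memLp_top_mul (memLp_top_mul (hw hj) ((hβ (by omega)).sub (hβ (by omega)))) hhb)]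
    congr 1; ext ω; simp only [Pi.mul_apply, Pi.sub_apply]; ring
  · obtain ⟨i, rfl⟩ : ∃ i, j = i + 1 := ⟨j - 1, by omega⟩
    have hi : i ≤ p := by omega
    have hcm : ∀ l ≤ i + 1, Measurable[genSig (Z i)] fun ω => (cumWeight μ A a Z l ω)⁻¹ :=
      fun l hl => measurable_cumWeight_inv (k := l) fun n hn => hmono n i (by omega) hi
    have hcb : ∀ l ≤ i + 1, MemLp (fun ω => (cumWeight μ A a Z l ω)⁻¹) ⊤ μ :=
      fun l hl => memLp_top_cumWeight_inv hle hpos (by omega)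
    have hwm : Measurable[genSig (Z i)] (ipWeight μ A a Z i) := measurable_ipWeight
      (fun n hn => hmono n i hn.le hi) (fun n hn => hadapt n i hn hi)
    rw [← integral_mul_ind_mul_regSeq_sub hA hY hle hpos hi
      (((hwm.mul (measurable_propen i).inv).mul (hh.mono (hmono k i (by omega) hi) le_rfl)).mul
        ((hcm k (by omega)).sub (hcm (k + 1) (by omega))))
      (memLp_top_mul (memLp_top_mul (memLp_top_mul (hw (by omega))
        (memLp_top_propen_inv hle hpos hi)) hhb)
        ((hcb k (by omega)).sub (hcb (k + 1) (by omega))))]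
    congr 1; ext ω
    have h1 := ipWeight_mul_ipWeight (μ := μ) (A := A) (a := a) (Z := Z) (j := i + 1) (k := k)
      (by omega) ω
    have h2 := ipWeight_mul_ipWeight (μ := μ) (A := A) (a := a) (Z := Z) (j := i + 1) (k := k + 1)
      (by omega) ω
    have h3 := ipWeight_succ (μ := μ) (A := A) (a := a) (Z := Z) i ω
    simp only [Pi.mul_apply, Pi.sub_apply, Pi.inv_apply]
    linear_combination (regSeq μ A a Y Z p (i + 2) ω - regSeq μ A a Y Z p (i + 1) ω) * h ω
      * (h1 - h2 + ((cumWeight μ A a Z k ω)⁻¹ - (cumWeight μ A a Z (k + 1) ω)⁻¹) * h3)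

/-- Adding to `ψ_a(Z)` any combination of weight increments with predictable coefficients cannot
decrease the variance. -/
lemma variance_psi_le_variance_add (hA : ∀ k, Measurable (A k)) (hY : MemLp Y ⊤ μ)
    (hle : ∀ k ≤ p, genSig (Z k) ≤ mΩ)
    (hmono : ∀ i j, i ≤ j → j ≤ p → genSig (Z i) ≤ genSig (Z j))
    (hadapt : ∀ i j, i < j → j ≤ p → Measurable[genSig (Z j)] (A i))
    (hpos : Positivity μ A a Z p) {h : ℕ → Ω → ℝ}
    (hh : ∀ k ≤ p, Measurable[genSig (Z k)] (h k)) (hhb : ∀ k ≤ p, MemLp (h k) ⊤ μ) :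
    variance (psi μ A a Y Z p) μ ≤ variance (psi μ A a Y Z p + fun ω =>
      ∑ k ∈ Finset.range (p + 1),
        h k ω * (ipWeight μ A a Z k ω - ipWeight μ A a Z (k + 1) ω)) μ := by
  set N : Ω → ℝ := fun ω => ∑ k ∈ Finset.range (p + 1),
    h k ω * (ipWeight μ A a Z k ω - ipWeight μ A a Z (k + 1) ω) with hN
  have hw : ∀ {i}, i ≤ p + 1 → MemLp (ipWeight μ A a Z i) ⊤ μ :=
    fun hi => memLp_top_ipWeight hA hle hpos hi
  have hψterm : ∀ j ∈ Finset.range (p + 2), MemLp (fun ω => ipWeight μ A a Z j ω *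
      (regSeq μ A a Y Z p (j + 1) ω - regSeq μ A a Y Z p j ω)) ⊤ μ := fun j hj => by
    have := Finset.mem_range.1 hj
    exact memLp_top_mul (hw (by omega)) ((memLp_top_regSeq hA hY hle hpos (by omega)).sub
      (memLp_top_regSeq hA hY hle hpos (by omega)))
  have hNterm : ∀ k ∈ Finset.range (p + 1), MemLp (fun ω =>
      h k ω * (ipWeight μ A a Z k ω - ipWeight μ A a Z (k + 1) ω)) ⊤ μ := fun k hk => by
    have := Finset.mem_range.1 hk
    exact memLp_top_mul (hhb k (by omega)) ((hw (by omega)).sub (hw (by omega)))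
  have hψb : MemLp (psi μ A a Y Z p) ⊤ μ := by
    rw [psi_eq_sum_ipWeight_mul]
    exact memLp_finsetSum _ hψterm
  have hNb : MemLp N ⊤ μ := memLp_finsetSum _ hNterm
  have hN0 : ∫ ω, N ω ∂μ = 0 := by
    rw [hN, integral_finsetSum _ fun k hk => integrable_of_memLp_top (hNterm k hk)]
    refine Finset.sum_eq_zero fun k hk => ?_
    have hk' := Nat.lt_succ_iff.1 (Finset.mem_range.1 hk)
    exact integral_mul_ipWeight_sub_succ hA hle hmono hadapt hpos hk' (hh k hk') (hhb k hk')
  have hψN : ∫ ω, (psi μ A a Y Z p * N) ω ∂μ = 0 := by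
    simp only [psi_eq_sum_ipWeight_mul, hN, Pi.mul_apply, Finset.sum_mul_sum]
    rw [integral_finsetSum _ fun j hj => integrable_of_memLp_top
      (memLp_finsetSum _ fun k hk => memLp_top_mul (hψterm j hj) (hNterm k hk))]
    refine Finset.sum_eq_zero fun j hj => ?_
    rw [integral_finsetSum _ fun k hk => integrable_of_memLp_top
      (memLp_top_mul (hψterm j hj) (hNterm k hk))]
    refine Finset.sum_eq_zero fun k hk => ?_
    have hj' := Nat.lt_succ_iff.1 (Finset.mem_range.1 hj)
    have hk' := Nat.lt_succ_iff.1 (Finset.mem_range.1 hk)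
    exact integral_ipWeight_mul_regSeq_sub_mul hA hY hle hmono hadapt hpos hj' hk'
      (hh k hk') (hhb k hk')
  have hψ2 : MemLp (psi μ A a Y Z p) 2 μ := hψb.mono_exponent le_top
  have hN2 : MemLp N 2 μ := hNb.mono_exponent le_top
  have hcov : cov[psi μ A a Y Z p, N; μ] = 0 := by
    rw [covariance_eq_sub hψ2 hN2, hψN, hN0, mul_zero, sub_zero]
  rw [variance_add hψ2 hN2, hcov]
  linarith [variance_nonneg N μ]

lemma sum_range_succ_mul_sub_eq (w d : ℕ → ℝ) (n : ℕ) :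
    ∑ k ∈ Finset.range (n + 1), w k * (d (k + 1) - d k) =
      w n * d (n + 1) - w 0 * d 0 + ∑ k ∈ Finset.range n, d (k + 1) * (w k - w (k + 1)) := by
  induction n with
  | zero => simp; ring
  | succ n ih =>
    rw [Finset.sum_range_succ, ih, Finset.sum_range_succ]
    ring

end InfluenceFunction

/-- Lemma 4.1, counterfactual-mean version.  If the families `B` and
`(G, B)` both satisfy positivity and `A_k ⊥⊥ G_k ∣ B_k` for every `k = 0, …, p`, then
`Var(ψ_a(B)) - Var(ψ_a((G, B))) ≥ 0`. -/
theorem variance_le_of_condIndep_add {Ω : Type*} [mΩ : MeasurableSpace Ω] [StandardBorelSpace Ω]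
    (P : Measure Ω) [IsProbabilityMeasure P] (p : ℕ)
    (A : ℕ → Ω → ℝ) (hA : ∀ k, Measurable (A k))
    (hAfin : ∀ k, (Set.range (A k)).Finite)
    (Y : Ω → ℝ) (hYm : Measurable Y) (hYbd : ∃ C : ℝ, ∀ ω, |Y ω| ≤ C)
    (a : ℕ → ℝ) (ha : ∀ k ≤ p, a k ∈ Set.range (A k))
    (K G B : ℕ → Set (Ω → ℝ)) (hKfin : ∀ k, (K k).Finite)
    (hGle : ∀ k, genSig (G k) ≤ mΩ) (hBle : ∀ k, genSig (B k) ≤ mΩ)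
    (hdisj : ∀ k ≤ p, Disjoint (G k) (B k))
    (hcover : ∀ k ≤ p, G k ∪ B k = A '' Set.Iio k ∪ ⋃ j ∈ Set.Iic k, K j)
    (hBpos : Positivity P A a B p)
    (hGBpos : Positivity P A a (fun k => G k ∪ B k) p)
    (hCI : ∀ k ≤ p,
      CondIndep (genSig (B k)) (MeasurableSpace.comap (A k) inferInstance) (genSig (G k))
        (hBle k) P) :
    0 ≤ variance (psi P A a Y B p) P - variance (psi P A a Y (fun k => G k ∪ B k) p) P := by
  obtain ⟨C, hC⟩ := hYbd
  have hY : MemLp Y ⊤ P := memLp_top_of_bound hYm.aestronglyMeasurable C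
    (Filter.Eventually.of_forall hC)
  set W : ℕ → Set (Ω → ℝ) := fun k => G k ∪ B k with hW
  have hWle : ∀ k ≤ p, genSig (W k) ≤ mΩ := fun k _ =>
    (genSig_union _ _).trans_le (sup_le (hGle k) (hBle k))
  have hBW : ∀ k, genSig (B k) ≤ genSig (W k) := fun k => genSig_mono Set.subset_union_right
  have hmono : ∀ i j, i ≤ j → j ≤ p → genSig (W i) ≤ genSig (W j) := fun i j hij hj => by
    refine genSig_mono ?_
    simp only [hW]
    rw [hcover i (hij.trans hj), hcover j hj]
    exact Set.union_subset_union (Set.image_mono (Set.Iio_subset_Iio hij))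
      (Set.biUnion_subset_biUnion_left (Set.Iic_subset_Iic.2 hij))
  have hadapt : ∀ i j, i < j → j ≤ p → Measurable[genSig (W j)] (A i) := fun i j hij hj => by
    refine measurable_genSig_of_mem ?_
    simp only [hW]
    rw [hcover j hj]
    exact Or.inl ⟨i, hij, rfl⟩
  have hprop : ∀ k ≤ p, propen P A a W k =ᵐ[P] propen P A a B k := fun k hk => by
    have hind : ind (A k) (a k) = (A k ⁻¹' {a k}).indicator (fun _ => (1 : ℝ)) := by
      ext ω
      by_cases h : A k ω = a k <;> simp [ind, h]
    simp only [propen, hW, genSig_union, hind]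
    exact condExp_indicator_sup_of_condIndep (hBle k) (hA k).comap_le (hGle k) (hCI k hk)
      ⟨{a k}, measurableSet_singleton _, rfl⟩
  have hweight : ∀ᵐ ω ∂P, ∀ k ≤ p + 1, ipWeight P A a B k ω = ipWeight P A a W k ω := by
    have : ∀ᵐ ω ∂P, ∀ k ≤ p, propen P A a W k ω = propen P A a B k ω :=
      ae_all_iff.2 fun k => by
        by_cases hk : k ≤ p
        · filter_upwards [hprop k hk] with ω hω _ using hω
        · exact Filter.Eventually.of_forall fun ω h => absurd h hk
    filter_upwards [this] with ω hω k hk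
    simp only [ipWeight, cumWeight]
    congr 2
    exact Finset.prod_congr rfl fun i hi =>
      (hω i (by have := Finset.mem_range.1 hi; omega)).symm
  have hle := variance_psi_le_variance_add (Y := Y) hA hY hWle hmono hadapt hGBpos
    (h := fun k ω => regSeq P A a Y B p (k + 1) ω - regSeq P A a Y W p (k + 1) ω)
    (fun k hk => ((measurable_regSeq_succ hk).mono (hBW k) le_rfl).sub
      (measurable_regSeq_succ hk))
    (fun k hk => (memLp_top_regSeq hA hY (fun k _ => hBle k) hBpos (by omega)).sub
      (memLp_top_regSeq hA hY hWle hGBpos (by omega)))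
  set N : Ω → ℝ := fun ω => ∑ k ∈ Finset.range (p + 1),
    (regSeq P A a Y B p (k + 1) ω - regSeq P A a Y W p (k + 1) ω) *
      (ipWeight P A a W k ω - ipWeight P A a W (k + 1) ω) with hN
  have hψ : psi P A a Y W p + N =ᵐ[P] fun ω => psi P A a Y B p ω +
      (∫ ω, breg P A a Y B p 0 ω ∂P - ∫ ω, breg P A a Y W p 0 ω ∂P) := by
    filter_upwards [hweight] with ω hω
    have hB : psi P A a Y B p ω = ∑ k ∈ Finset.range (p + 2), ipWeight P A a W k ω *
        (regSeq P A a Y B p (k + 1) ω - regSeq P A a Y B p k ω) := by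
      rw [psi_eq_sum_ipWeight_mul]
      exact Finset.sum_congr rfl fun k hk => by
        rw [hω k (by have := Finset.mem_range.1 hk; omega)]
    have hparts := sum_range_succ_mul_sub_eq (fun k => ipWeight P A a W k ω)
      (fun k => regSeq P A a Y B p k ω - regSeq P A a Y W p k ω) (p + 1)
    simp only [regSeq_last, sub_self, mul_zero, ipWeight_zero, regSeq_zero, one_mul,
      zero_sub] at hparts
    have hsplit : psi P A a Y B p ω - psi P A a Y W p ω = ∑ k ∈ Finset.range (p + 1 + 1),
        ipWeight P A a W k ω * (regSeq P A a Y B p (k + 1) ω - regSeq P A a Y W p (k + 1) ω -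
          (regSeq P A a Y B p k ω - regSeq P A a Y W p k ω)) := by
      rw [hB, psi_eq_sum_ipWeight_mul, ← Finset.sum_sub_distrib]
      exact Finset.sum_congr rfl fun k _ => by ring
    simp only [Pi.add_apply, hN]
    linarith
  have hψB : AEStronglyMeasurable (psi P A a Y B p) P := by
    rw [psi_eq_sum_ipWeight_mul]
    refine (memLp_finsetSum (p := ⊤) _ fun k hk => ?_).aestronglyMeasurable
    have := Finset.mem_range.1 hk
    exact memLp_top_mul (memLp_top_ipWeight hA (fun k _ => hBle k) hBpos (by omega))
      ((memLp_top_regSeq hA hY (fun k _ => hBle k) hBpos (by omega)).sub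
        (memLp_top_regSeq hA hY (fun k _ => hBle k) hBpos (by omega)))
  rw [variance_congr hψ, variance_add_const hψB] at hle
  exact sub_nonneg.2 hle
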